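/- Let ϑ and ϑ' be commuting involutions of g, both of maximal rank, with quaternionic decomposition g = g₀₀ ⊕ g₀₁ ⊕ g₁₀ ⊕ g₁₁ (the first index records the ϑ-eigenvalue, the second the ϑ'-eigenvalue). Then the following conditions are equivalent: (i) g₀₁ ⊕ g₁₀, the (−1)-eigenspace of ϑϑ', contains a regular semisimple element of g; (ii) g₀₁ contains a Cartan subalgebra of g^{ϑ} = g₀₀ ⊕ g₀₁; (iii) g₁₀ contains a Cartan subalgebra of g^{ϑ'} = g₀₀ ⊕ g₁₀. -/

import Mathlib

open LieAlgebra Module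

variable (k : Type*) [Field k] [IsAlgClosed k] [CharZero k]
variable (g : Type*) [LieRing g] [LieAlgebra k g] [FiniteDimensional k g]
  [LieAlgebra.IsSemisimple k g]

/-- The eigenspace of a Lie algebra automorphism `σ` for the eigenvalue `c`. -/
noncomputable def eigSub (σ : g ≃ₗ⁅k⁆ g) (c : k) : Submodule k g :=
  Module.End.eigenspace (σ.toLinearEquiv : g →ₗ[k] g) c

/-- A Lie algebra involution: an automorphism `σ` with `σ ∘ σ = id`. -/
def IsInvolution (σ : g ≃ₗ⁅k⁆ g) : Prop := ∀ x, σ (σ x) = x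

/-- Two commuting involutions. -/
def CommutingInvolutions (σ₁ σ₂ : g ≃ₗ⁅k⁆ g) : Prop :=
  IsInvolution k g σ₁ ∧ IsInvolution k g σ₂ ∧ ∀ x, σ₁ (σ₂ x) = σ₂ (σ₁ x)

/-- The subspace `g_{ij}` of the quaternionic decomposition determined by commuting
involutions `σ₁, σ₂`: here `i, j : Bool` and `false, true` encode the exponents `0, 1`
of the eigenvalues `(-1)^i`, `(-1)^j`. -/
noncomputable def qSpace (σ₁ σ₂ : g ≃ₗ⁅k⁆ g) (i j : Bool) : Submodule k g :=
  eigSub k g σ₁ (if i then -1 else 1) ⊓ eigSub k g σ₂ (if j then -1 else 1)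

/-- `x` is a semisimple element of `g`: `ad x` is a semisimple endomorphism. -/
def IsSSElt (x : g) : Prop := Module.End.IsSemisimple (ad k g x)

/-- `x` is a nilpotent element of `g`: `ad x` is a nilpotent endomorphism. -/
def IsNilpElt (x : g) : Prop := IsNilpotent (ad k g x)

/-- `x` is a regular element of `g`: the dimension of its centralizer equals the rank of `g`,
i.e. the dimension of a Cartan subalgebra of `g`. -/
def IsRegElt (x : g) : Prop :=
  ∃ H : LieSubalgebra k g, H.IsCartanSubalgebra ∧
    Module.finrank k (LinearMap.ker (ad k g x)) = Module.finrank k H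

/-- An involution is of maximal rank if its `(-1)`-eigenspace contains a Cartan
subalgebra of `g`. -/
def IsMaxRank (σ : g ≃ₗ⁅k⁆ g) : Prop :=
  ∃ H : LieSubalgebra k g, H.IsCartanSubalgebra ∧ H.toSubmodule ≤ eigSub k g σ (-1)

/-- The centralizer of an element `x`, as a Lie subalgebra of `g`. -/
def zg (x : g) : LieSubalgebra k g where
  carrier := {y | ⁅x, y⁆ = 0}
  add_mem' := by
    intro a b ha hb
    simp only [Set.mem_setOf_eq] at *
    rw [lie_add, ha, hb, add_zero]
  zero_mem' := by simp
  smul_mem' := by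
    intro t a ha
    simp only [Set.mem_setOf_eq] at *
    rw [lie_smul, ha, smul_zero]
  lie_mem' := by
    intro a b ha hb
    simp only [Set.mem_setOf_eq] at *
    rw [leibniz_lie, ha, hb, lie_zero, zero_lie, add_zero]

/-- The fixed-point subalgebra of a Lie algebra automorphism. -/
def fixSubalgebra (σ : g ≃ₗ⁅k⁆ g) : LieSubalgebra k g where
  carrier := {x | σ x = x}
  add_mem' := by
    intro a b ha hb
    simp only [Set.mem_setOf_eq] at *
    rw [show σ (a + b) = σ a + σ b from σ.toLieHom.map_add a b, ha, hb]
  zero_mem' := by simp only [Set.mem_setOf_eq]; exact σ.toLieHom.map_zero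
  smul_mem' := by
    intro t a ha
    simp only [Set.mem_setOf_eq] at *
    rw [show σ (t • a) = t • σ a from σ.toLieHom.map_smul t a, ha]
  lie_mem' := by
    intro a b ha hb
    simp only [Set.mem_setOf_eq] at *
    rw [LieEquiv.map_lie σ a b, ha, hb]

/-- The exponential of an endomorphism, as a finite sum (which is the genuine exponential
when the endomorphism is nilpotent). -/
noncomputable def expEnd (f : Module.End k g) : Module.End k g :=
  ∑ i ∈ Finset.range (Module.finrank k g + 1), (i.factorial : k)⁻¹ • f ^ i

/-- An automorphism of `g` is inner if it lies in the subgroup of automorphisms generated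
by the exponentials `exp (ad x)` with `ad x` nilpotent. -/
noncomputable def IsInnerAut (μ : g ≃ₗ⁅k⁆ g) : Prop :=
  μ.toLinearEquiv ∈ Subgroup.closure
    {e : g ≃ₗ[k] g | ∃ x : g, IsNilpotent (ad k g x) ∧
      (e : g →ₗ[k] g) = expEnd k g (ad k g x)}

/-- `σ` and `τ` are conjugate by an inner automorphism of `g`. -/
noncomputable def InnerConj (σ τ : g ≃ₗ⁅k⁆ g) : Prop :=
  ∃ φ : g ≃ₗ⁅k⁆ g, IsInnerAut k g φ ∧ ∀ x, τ x = φ (σ (φ.symm x))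

/-- A dyad: a pair of distinct commuting involutions that are conjugate by an inner
automorphism of `g`. -/
noncomputable def IsDyad (σ₁ σ₂ : g ≃ₗ⁅k⁆ g) : Prop :=
  IsInvolution k g σ₁ ∧ IsInvolution k g σ₂ ∧ σ₁ ≠ σ₂ ∧
    (∀ x, σ₁ (σ₂ x) = σ₂ (σ₁ x)) ∧ InnerConj k g σ₁ σ₂

/-- The span of all brackets `⁅x, y⁆` with `x, y` in a subspace `m`. -/
noncomputable def bracketSpan (m : Submodule k g) : Submodule k g :=
  Submodule.span k {z | ∃ x ∈ m, ∃ y ∈ m, z = ⁅x, y⁆}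

/-- `c` is a Cartan subspace of a subspace `m ⊆ g`: it consists of pairwise commuting
semisimple elements of `g` and is maximal among such subspaces of `m`. -/
def IsCartanSubspace (m c : Submodule k g) : Prop :=
  c ≤ m ∧ (∀ x ∈ c, IsSSElt k g x) ∧ (∀ x ∈ c, ∀ y ∈ c, ⁅x, y⁆ = 0) ∧
    ∀ c' : Submodule k g, c' ≤ m → (∀ x ∈ c', IsSSElt k g x) →
      (∀ x ∈ c', ∀ y ∈ c', ⁅x, y⁆ = 0) → c ≤ c' → c' = c

theorem aux_conj {A L : Type*} [CommRing A] [LieRing L] [LieAlgebra A L] [Algebra ℚ A]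
    (V c K : Submodule A L) (hcV : c ≤ V) (hKV : ∀ y ∈ K, ∀ v ∈ V, ⁅y, v⁆ ∈ V)
    (x0 : L) (hx0 : x0 ∈ c) (hs : ∀ v ∈ V, ∃ y ∈ K, ∃ c' ∈ c, v = ⁅x0, y⁆ + c')
    (s : A) (n : ℕ) (hsn : s ^ n = 0) (v : L) (hv : v ∈ V) :
    ∃ φ : L ≃ₗ⁅A⁆ L, φ (x0 + s • v) ∈ c := by
  letI : Module ℚ L := Module.compHom L (algebraMap ℚ A)
  have hq : ∀ (q : ℚ) (z : L), q • z = (algebraMap ℚ A q) • z := fun _ _ => rfl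
  letI : LieAlgebra ℚ L := { lie_smul := fun q x y => by rw [hq, hq, lie_smul] }
  have key : ∀ j : ℕ, ∃ φ : L ≃ₗ⁅A⁆ L, ∃ d ∈ c, ∃ w ∈ V,
      φ (x0 + s • v) = x0 + s • d + s ^ (j+1) • w := by
    intro j
    induction j with
    | zero => exact ⟨LieEquiv.refl, 0, c.zero_mem, v, hv, by simp⟩
    | succ j ih =>
      obtain ⟨φ, d, hd, w, hw, h⟩ := ih
      obtain ⟨y, hy, c', hc', e⟩ := hs w hw
      let D : LieDerivation A L L := s ^ (j+1) • LieDerivation.ad A L y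
      have hDa : ∀ z, D z = s ^ (j+1) • ⁅y, z⁆ := fun z => by simp [D]
      have hDpow : ∀ m z, (D.toLinearMap ^ m) z = (s ^ (j+1)) ^ m • ((ad A L y) ^ m) z := by
        intro m
        induction m with
        | zero => intro z; simp
        | succ m ihm =>
          intro z
          rw [pow_succ', Module.End.mul_apply, ihm]
          change D _ = _
          rw [hDa, lie_smul, smul_smul, ← pow_succ', pow_succ' (ad A L y), Module.End.mul_apply]
          rfl
      have hDn : D.toLinearMap ^ n = 0 := by
        ext z
        rw [hDpow, ← pow_mul, mul_comm, pow_mul, hsn, zero_pow (by omega)]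
        simp
      have hDV : ∀ z ∈ V, ∀ m, ((ad A L y) ^ m) z ∈ V := by
        intro z hz m
        induction m with
        | zero => simpa
        | succ m ihm =>
          rw [pow_succ', Module.End.mul_apply]
          exact hKV y hy _ ihm
      have hexp : ∀ z ∈ V, ∃ u ∈ V, LieDerivation.exp D ⟨n, hDn⟩ z
          = z + s ^ (j+1) • ⁅y, z⁆ + s ^ (j + 2) • u := by
        intro z hz
        have hDn2 : D.toLinearMap ^ (n + 2) = 0 := by rw [pow_add, hDn, zero_mul]
        have h1 : LieDerivation.exp D ⟨n, hDn⟩ z = IsNilpotent.exp D.toLinearMap z := rfl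
        rw [h1, IsNilpotent.exp_eq_sum hDn2, LinearMap.sum_apply, Finset.sum_range_succ',
          Finset.sum_range_succ']
        refine ⟨∑ i ∈ Finset.range n, (((i + 1 + 1).factorial : ℚ)⁻¹ •
          (s ^ (j + i * (j + 1)) • ((ad A L y) ^ (i+2)) z)), ?_, ?_⟩
        · refine V.sum_mem fun i _ => ?_
          rw [hq]
          exact V.smul_mem _ (V.smul_mem _ (hDV z hz _))
        · have h2 : ∀ i : ℕ, (((i.factorial : ℚ)⁻¹ • D.toLinearMap ^ i) : L →ₗ[A] L) z =
              (i.factorial : ℚ)⁻¹ • ((s ^ (j+1)) ^ i • ((ad A L y) ^ i) z) := by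
            intro i
            rw [← hDpow]; rfl
          simp only [h2]
          rw [Finset.smul_sum]
          have h3 : ∀ i : ℕ, s ^ (j+2) • (((i + 1 + 1).factorial : ℚ)⁻¹ •
              (s ^ (j + i * (j + 1)) • ((ad A L y) ^ (i+2)) z)) =
              ((i + 1 + 1).factorial : ℚ)⁻¹ • ((s ^ (j+1)) ^ (i+1+1) • ((ad A L y) ^ (i+1+1)) z) := by
            intro i
            rw [hq, hq, smul_comm, smul_smul (s ^ (j+2)), ← pow_add, ← pow_mul]
            congr 3
            ring
          simp only [h3]
          simp
          abel
      obtain ⟨u1, hu1, e1⟩ := hexp x0 (hcV hx0)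
      obtain ⟨u2, hu2, e2⟩ := hexp d (hcV hd)
      obtain ⟨u3, hu3, e3⟩ := hexp w hw
      refine ⟨φ.trans (LieDerivation.exp D ⟨n, hDn⟩), d + s ^ j • c', ?_,
        ⁅y, d⁆ + u1 + s • u2 + s ^ j • ⁅y, w⁆ + s ^ (j + 1) • u3, ?_, ?_⟩
      · exact c.add_mem hd (c.smul_mem _ hc')
      · have := hKV y hy d (hcV hd)
        have := hKV y hy w hw
        refine V.add_mem (V.add_mem (V.add_mem (V.add_mem ?_ ?_) ?_) ?_) ?_ <;>
        first | assumption | (apply V.smul_mem; assumption)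
      · rw [LieEquiv.trans_apply, h]
        simp only [map_add, map_smul, e1, e2, e3]
        have : s ^ (j+1) • w = s ^ (j+1) • (c' - ⁅y, x0⁆) := by
          conv_lhs => rw [e]
          rw [← lie_skew y x0]; congr 1; abel
        rw [smul_add (s^(j+1)), smul_add (s^(j+1)), this]
        module
  obtain ⟨φ, d, hd, w, hw, h⟩ := key n
  refine ⟨φ, ?_⟩
  rw [h, pow_succ, hsn]
  simpa using c.add_mem hx0 (c.smul_mem _ hd)

section
open TensorProduct
variable {k : Type*} [Field k] [CharZero k]
variable {g : Type*} [LieRing g] [LieAlgebra k g] [FiniteDimensional k g]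

theorem aux_ad_baseChange {L : Type*} [AddCommGroup L] [Module k L] (ψ : L →ₗ[k] g)
    (A : Type*) [CommRing A] [Algebra k A] (z : A ⊗[k] L) :
    ((LinearMap.tensorProduct k A g g).comp (LinearMap.baseChange A
      (((ad k g) : g →ₗ[k] Module.End k g) ∘ₗ ψ))) z
      = (ad A (A ⊗[k] g)) (ψ.baseChange A z) := by
  induction z using TensorProduct.induction_on with
  | zero => simp
  | add x y hx hy => rw [map_add, hx, hy, map_add, map_add]
  | tmul a x =>
    ext y
    simp [LinearMap.tensorProduct, smul_tmul']

theorem aux_charpoly {L : Type*} [AddCommGroup L] [Module k L] (ψ : L →ₗ[k] g)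
    {ι : Type*} [Fintype ι] [DecidableEq ι] (b : Basis ι k L)
    (A : Type*) [CommRing A] [Algebra k A] (r : ℕ) (z : ι → A) :
    MvPolynomial.aeval z
        ((LinearMap.polyCharpoly (((ad k g) : g →ₗ[k] Module.End k g) ∘ₗ ψ) b).coeff r)
      = ((ad A (A ⊗[k] g)) (ψ.baseChange A (∑ i, z i ⊗ₜ[k] b i))).charpoly.coeff r := by
  have h := LinearMap.polyCharpolyAux_map_aeval (((ad k g) : g →ₗ[k] Module.End k g) ∘ₗ ψ) b
    (Module.Free.chooseBasis k g) A z
  have h2 := congrArg (fun p => Polynomial.coeff p r) h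
  rw [Polynomial.coeff_map] at h2
  rw [LinearMap.polyCharpoly]
  refine h2.trans ?_
  rw [aux_ad_baseChange]
  congr 5
  rw [Basis.repr_symm_apply, Finsupp.linearCombination_apply, Finsupp.sum_fintype _ _ (by simp)]
  simp [smul_tmul']

theorem aux_bc_mono {M : Type*} [AddCommGroup M] [Module k M] (A : Type*) [CommRing A] [Algebra k A]
    (V : Submodule k M) (D : Submodule A (A ⊗[k] M))
    (h : ∀ x ∈ V, ∀ a : A, a ⊗ₜ x ∈ D) : V.baseChange A ≤ D := by
  rintro _ ⟨z, rfl⟩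
  induction z using TensorProduct.induction_on with
  | zero => simp
  | add x y hx hy => rw [map_add]; exact D.add_mem hx hy
  | tmul a x => exact h x x.2 a

theorem aux_b2 (A : Type*) [CommRing A] [Algebra k A] (V K : Submodule k g)
    (hKV : ∀ y ∈ K, ∀ v ∈ V, ⁅y, v⁆ ∈ V) :
    ∀ y ∈ K.baseChange A, ∀ v ∈ V.baseChange A, ad A (A ⊗[k] g) y v ∈ V.baseChange A := by
  rintro _ ⟨y, rfl⟩ _ ⟨w, rfl⟩
  induction y using TensorProduct.induction_on with
  | zero => simp
  | add x y hx hy => rw [map_add, map_add]; exact Submodule.add_mem _ hx hy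
  | tmul a x =>
    induction w using TensorProduct.induction_on with
    | zero => rw [map_zero, map_zero]; exact zero_mem _
    | add x y hx hy => rw [map_add, map_add]; exact Submodule.add_mem _ hx hy
    | tmul b y =>
      exact Submodule.tmul_mem_baseChange_of_mem (a * b) (hKV x x.2 y y.2)

theorem aux_b3 (A : Type*) [CommRing A] [Algebra k A] (V c K : Submodule k g)
    (x0 : g) (hs : ∀ v ∈ V, ∃ y ∈ K, ∃ c' ∈ c, v = ⁅x0, y⁆ + c') :
    ∀ v ∈ V.baseChange A, ∃ y ∈ K.baseChange A, ∃ c' ∈ c.baseChange A,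
            v = ad A (A ⊗[k] g) ((1 : A) ⊗ₜ[k] x0) y + c' := by
  rintro _ ⟨w, rfl⟩
  induction w using TensorProduct.induction_on with
  | zero => exact ⟨0, zero_mem _, 0, zero_mem _, by rw [map_zero, map_zero, add_zero]⟩
  | add x y hx hy =>
    obtain ⟨y1, h1, c1, h2, e1⟩ := hx
    obtain ⟨y2, h3, c2, h4, e2⟩ := hy
    refine ⟨y1 + y2, add_mem h1 h3, c1 + c2, add_mem h2 h4, ?_⟩
    rw [map_add, e1, e2, map_add]; abel
  | tmul b y =>
    obtain ⟨y1, h1, c1, h2, e1⟩ := hs y y.2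
    refine ⟨b ⊗ₜ y1, Submodule.tmul_mem_baseChange_of_mem _ h1, b ⊗ₜ c1,
      Submodule.tmul_mem_baseChange_of_mem _ h2, ?_⟩
    change b ⊗ₜ[k] (y : g) = (1 * b) ⊗ₜ[k] ⁅x0, y1⁆ + _
    rw [one_mul, ← tmul_add, ← e1]

theorem lemma_T (V c K : Submodule k g) (hcV : c ≤ V) (hKV : ∀ y ∈ K, ∀ v ∈ V, ⁅y, v⁆ ∈ V)
    (x0 : g) (hx0 : x0 ∈ c) (hs : ∀ v ∈ V, ∃ y ∈ K, ∃ c' ∈ c, v = ⁅x0, y⁆ + c')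
    (hreg : ∃ v ∈ V, LieAlgebra.IsRegular k v) : ∃ v ∈ c, LieAlgebra.IsRegular k v := by
  classical
  by_contra hcon
  push Not at hcon
  obtain ⟨v, hv, hvr⟩ := hreg
  set r := LieAlgebra.rank k g with hr
  have hdef : ∀ x : g, LieAlgebra.IsRegular k x ↔ (ad k g x).charpoly.coeff r ≠ 0 :=
    fun x => LieAlgebra.isRegular_def k x
  let bc := Module.finBasis k c
  have hP : (LinearMap.polyCharpoly (((ad k g) : g →ₗ[k] Module.End k g) ∘ₗ c.subtype) bc).coeff r
      = 0 := by
    apply MvPolynomial.funext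
    intro z
    have := LinearMap.polyCharpoly_coeff_eval (((ad k g) : g →ₗ[k] Module.End k g) ∘ₗ c.subtype) bc
      (bc.equivFun.symm z) r
    rw [show (bc.repr (bc.equivFun.symm z) : _ → k) = z from bc.equivFun.apply_symm_apply z] at this
    rw [this, map_zero]
    have h2 := hcon _ (bc.equivFun.symm z).2
    rw [hdef, not_not] at h2
    exact h2
  have hA : ∀ (A : Type _) [CommRing A] [Algebra k A] (X : A ⊗[k] g),
      X ∈ c.baseChange A → ((ad A (A ⊗[k] g)) X).charpoly.coeff r = 0 := by
    intro A _ _ X hX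
    obtain ⟨z, rfl⟩ := hX
    have h3 := aux_charpoly c.subtype bc A r ((bc.baseChange A).equivFun z)
    rw [hP, map_zero] at h3
    rw [h3]
    congr 5
    conv_lhs => rw [← (bc.baseChange A).sum_equivFun z]
    simp [smul_tmul']
  let ψ : (Fin 2 → k) →ₗ[k] g := (Pi.basisFun k (Fin 2)).constr k ![x0, v - x0]
  let b2 := Pi.basisFun k (Fin 2)
  let P := (LinearMap.polyCharpoly (((ad k g) : g →ₗ[k] Module.End k g) ∘ₗ ψ) b2).coeff r
  have hψ : ∀ (A : Type _) [CommRing A] [Algebra k A] (z : Fin 2 → A),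
      ψ.baseChange A (∑ i, z i ⊗ₜ[k] b2 i) = z 0 ⊗ₜ x0 + z 1 ⊗ₜ (v - x0) := by
    intro A _ _ z
    simp only [Fin.sum_univ_two, map_add, LinearMap.baseChange_tmul, ψ, b2, Basis.constr_basis]
    rfl
  have hvV : v - x0 ∈ V := V.sub_mem hv (hcV hx0)
  let q : Polynomial k := MvPolynomial.aeval ![1, Polynomial.X] P
  have hq : q = 0 := by
    by_contra hq0
    have hdvd : ∀ n : ℕ, Polynomial.X ^ n ∣ q := by
      intro n
      let I : Ideal (Polynomial k) := Ideal.span {Polynomial.X ^ n}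
      let A := Polynomial k ⧸ I
      let s : A := Ideal.Quotient.mkₐ k I Polynomial.X
      have hsn : s ^ n = 0 := by
        rw [← map_pow]
        exact Ideal.Quotient.eq_zero_iff_mem.mpr (Ideal.subset_span rfl)
      have hz : Ideal.Quotient.mkₐ k I q = 0 := by
        have e1 : Ideal.Quotient.mkₐ k I q = MvPolynomial.aeval ![1, s] P := by
          rw [← AlgHom.comp_apply, MvPolynomial.comp_aeval]
          congr 2
          ext i; fin_cases i <;> simp [s]
        rw [e1, aux_charpoly, hψ]
        have hb1 : c.baseChange A ≤ V.baseChange A := aux_bc_mono A _ _ fun x hx a =>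
          Submodule.tmul_mem_baseChange_of_mem _ (hcV hx)
        have hb2 := aux_b2 A V K hKV
        have hb3 := aux_b3 A V c K x0 hs
        obtain ⟨φ, hφ⟩ := aux_conj (A := A) (L := A ⊗[k] g) (V.baseChange A) (c.baseChange A)
          (K.baseChange A) hb1 hb2 ((1 : A) ⊗ₜ x0)
          (Submodule.tmul_mem_baseChange_of_mem _ hx0) hb3 s n hsn ((1 : A) ⊗ₜ (v - x0))
          (Submodule.tmul_mem_baseChange_of_mem _ hvV)
        have h4 := hA A _ hφ
        rw [← h4]
        have h5 : ∀ X : A ⊗[k] g, ad A (A ⊗[k] g) (φ X) =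
            φ.toLinearEquiv.conj (ad A (A ⊗[k] g) X) := by
          intro X
          apply LinearMap.ext
          intro Y
          rw [LinearEquiv.conj_apply_apply, ad_apply, ad_apply]
          change _ = φ ⁅X, φ.symm Y⁆
          rw [LieEquiv.map_lie, LieEquiv.apply_symm_apply]
        rw [h5, LinearEquiv.charpoly_conj]
        congr 4
        simp [smul_tmul']
      exact Ideal.mem_span_singleton.mp (Ideal.Quotient.eq_zero_iff_mem.mp hz)
    have := Polynomial.natDegree_le_of_dvd (hdvd (q.natDegree + 1)) hq0
    rw [Polynomial.natDegree_X_pow] at this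
    omega
  have hev : MvPolynomial.aeval ![1, 1] P = (0 : k) := by
    have : Polynomial.aeval (1 : k) q = 0 := by rw [hq, map_zero]
    rw [← this, ← AlgHom.comp_apply, MvPolynomial.comp_aeval]
    congr 2
    ext i; fin_cases i <;> simp
  rw [hdef] at hvr
  apply hvr
  have h6 := LinearMap.polyCharpoly_coeff_eval (((ad k g) : g →ₗ[k] Module.End k g) ∘ₗ ψ) b2
    ![1, 1] r
  have h7 : ψ ![1, 1] = v := by
    simp [ψ, Basis.constr_apply_fintype, Fin.sum_univ_two]
  rw [LinearMap.comp_apply, h7] at h6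
  rw [← hev]
  exact h6.symm
end

section
variable {k : Type*} [Field k] [IsAlgClosed k] [CharZero k]
variable {g : Type*} [LieRing g] [LieAlgebra k g] [FiniteDimensional k g]
  [LieAlgebra.IsSemisimple k g]

theorem aux_gen {V : Type*} [AddCommGroup V] [Module k V] [FiniteDimensional k V]
    (f s n : Module.End k V) (hs : s.IsSemisimple) (hn : IsNilpotent n) (hc : Commute f n)
    (h : f = n + s) (c : k) : f.maxGenEigenspace c = s.eigenspace c := by
  apply le_antisymm
  · intro v hv
    rw [← (Module.End.isFinitelySemisimple_iff_isSemisimple.mpr hs).maxGenEigenspace_eq_eigenspace]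
    rw [Module.End.mem_maxGenEigenspace] at hv ⊢
    obtain ⟨N, hN⟩ := hv
    obtain ⟨M, hM⟩ := hn
    refine ⟨N + M, ?_⟩
    have e : s - c • (1 : Module.End k V) = (f - c • 1) + (-n) := by rw [h]; abel
    have hc' : Commute (f - c • (1 : Module.End k V)) (-n) := by
      apply Commute.neg_right
      apply Commute.sub_left hc
      exact (Commute.one_left n).smul_left c
    rw [e, hc'.add_pow', LinearMap.sum_apply]
    apply Finset.sum_eq_zero
    intro p hp
    rw [Finset.HasAntidiagonal.mem_antidiagonal] at hp
    rw [LinearMap.smul_apply]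
    by_cases hj : M ≤ p.2
    · have : (-n) ^ p.2 = 0 := by
        rw [neg_pow, pow_eq_zero_of_le hj hM, mul_zero]
      rw [this]; simp
    · have : N ≤ p.1 := by omega
      rw [(hc'.pow_pow p.1 p.2).eq, Module.End.mul_apply, ← Nat.sub_add_cancel this, pow_add,
        Module.End.mul_apply, hN]
      simp
  · intro v hv
    rw [Module.End.mem_maxGenEigenspace]
    obtain ⟨M, hM⟩ := hn
    refine ⟨M, ?_⟩
    have key : ∀ j, ((f - c • (1 : Module.End k V)) ^ j) v = (n ^ j) v := by
      intro j
      induction j with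
      | zero => rfl
      | succ j ih =>
        rw [pow_succ', Module.End.mul_apply, ih, pow_succ', Module.End.mul_apply]
        have hs' : Commute s n := by
          have : s = f - n := by rw [h]; abel
          rw [this]; exact hc.sub_left (Commute.refl n)
        have : s ((n ^ j) v) = c • (n ^ j) v := by
          have h1 := LinearMap.congr_fun (hs'.pow_right j).eq v
          rw [Module.End.mul_apply, Module.End.mul_apply] at h1
          rw [h1, Module.End.mem_eigenspace_iff.mp hv, map_smul]
        rw [h]
        simp [this]
    rw [key, hM]; rfl

theorem ad_inj {x y : g} (h : ad k g x = ad k g y) : x = y := by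
  have h2 : x - y ∈ LieAlgebra.center k g := by
    rw [LieModule.mem_maxTrivSubmodule]
    intro z
    have := LinearMap.congr_fun h z
    rw [ad_apply, ad_apply] at this
    rw [← lie_skew, sub_lie, this]; simp
  rw [LieAlgebra.center_eq_bot] at h2
  exact sub_eq_zero.mp (by simpa using h2)

theorem ss_span {V : Type*} [AddCommGroup V] [Module k V] [FiniteDimensional k V]
    (s : Module.End k V) (hs : s.IsSemisimple) (P : V → Prop)
    (h0 : P 0) (hadd : ∀ x y, P x → P y → P (x + y)) (he : ∀ (c : k) (x : V), s x = c • x → P x) (x : V) :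
    P x := by
  have ht : ⨆ c, s.eigenspace c = ⊤ := by
    rw [← hs.iSup_maxGenEigenspace_eq_top_iff]
    exact Module.End.iSup_maxGenEigenspace_eq_top s
  have hx : x ∈ ⨆ c, s.eigenspace c := by rw [ht]; trivial
  induction hx using Submodule.iSup_induction' with
  | mem i x hx => exact he i x (Module.End.mem_eigenspace_iff.mp hx)
  | zero => exact h0
  | add x y _ _ hx hy => exact hadd x y hx hy

theorem jordan (x : g) : ∃ s n : g, x = s + n ∧ (ad k g s).IsSemisimple ∧
    IsNilpotent (ad k g n) ∧ ad k g s ∈ Algebra.adjoin k {ad k g x} := by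
  obtain ⟨n, hn, s, hs, hnn, hss, e⟩ := (ad k g x).exists_isNilpotent_isSemisimple
  have hc : Commute (ad k g x) n := by
    have := Algebra.commute_of_mem_adjoin_singleton_of_commute hn (Commute.refl (ad k g x))
    exact this
  have hgen := fun c => aux_gen (ad k g x) s n hss hnn hc e c
  have hder : ∀ y z : g, s ⁅y, z⁆ = ⁅y, s z⁆ - ⁅z, s y⁆ := by
    intro y z
    revert z
    refine ss_span s hss (fun y => ∀ z, s ⁅y, z⁆ = ⁅y, s z⁆ - ⁅z, s y⁆) (by simp) ?_ ?_ y
    · intro y1 y2 h1 h2 z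
      rw [add_lie, map_add, h1, h2, map_add, lie_add, add_lie]; abel
    · intro a y hy z
      refine ss_span s hss (fun z => s ⁅y, z⁆ = ⁅y, s z⁆ - ⁅z, s y⁆) (by simp) ?_ ?_ z
      · intro z1 z2 h1 h2
        rw [lie_add, map_add, h1, h2, map_add, lie_add, add_lie]; abel
      · intro b z hz
        have hy' : y ∈ (ad k g x).maxGenEigenspace a := by
          rw [hgen, Module.End.mem_eigenspace_iff]; exact hy
        have hz' : z ∈ (ad k g x).maxGenEigenspace b := by
          rw [hgen, Module.End.mem_eigenspace_iff]; exact hz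
        have h3 : ⁅y, z⁆ ∈ (ad k g x).maxGenEigenspace (a + b) :=
          LieModule.lie_mem_maxGenEigenspace_toEnd hy' hz'
        rw [hgen, Module.End.mem_eigenspace_iff] at h3
        rw [h3, hy, hz, lie_smul, lie_smul, ← lie_skew z y, add_smul, smul_neg, sub_neg_eq_add,
          add_comm]
  let D : LieDerivation k g g := { s with leibniz' := hder }
  obtain ⟨s', hs'⟩ := LieDerivation.IsKilling.exists_eq_ad D
  have hs2 : ad k g s' = s := by
    ext y
    have := congrArg (fun D => D y) hs'
    exact (by simpa using this : ⁅s', y⁆ = D y)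
  refine ⟨s', x - s', by abel, hs2 ▸ hss, ?_, hs2 ▸ hs⟩
  rw [map_sub, hs2, e, add_sub_cancel_right]; exact hnn
end

section
variable {k : Type*} [Field k] [IsAlgClosed k] [CharZero k]
variable {g : Type*} [LieRing g] [LieAlgebra k g] [FiniteDimensional k g]
  [LieAlgebra.IsSemisimple k g]

theorem commute_ad {x y : g} (h : ⁅x, y⁆ = 0) : Commute (ad k g x) (ad k g y) := by
  apply LinearMap.ext
  intro z
  rw [Module.End.mul_apply, Module.End.mul_apply, ad_apply, ad_apply, ad_apply, ad_apply,
    leibniz_lie, h, zero_lie, zero_add]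

theorem of_commute_ad {x y : g} (h : Commute (ad k g x) (ad k g y)) : ⁅x, y⁆ = 0 := by
  apply ad_inj (k := k)
  apply LinearMap.ext
  intro z
  have := LinearMap.congr_fun h.eq z
  rw [Module.End.mul_apply, Module.End.mul_apply, ad_apply, ad_apply, ad_apply, ad_apply] at this
  rw [map_zero, ad_apply, lie_lie, this]; simp

theorem lq_add (θ : g ≃ₗ⁅k⁆ g) (x y : g) : θ (x + y) = θ x + θ y := θ.toLieHom.map_add x y
theorem lq_smul (θ : g ≃ₗ⁅k⁆ g) (c : k) (x : g) : θ (c • x) = c • θ x := θ.toLieHom.map_smul c x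
theorem lq_zero (θ : g ≃ₗ⁅k⁆ g) : θ 0 = 0 := θ.toLieHom.map_zero

theorem ss_map (θ : g ≃ₗ⁅k⁆ g) {s : g} (h : (ad k g s).IsSemisimple) :
    (ad k g (θ s)).IsSemisimple := by
  rw [← LieAlgebra.conj_ad_apply]
  change (θ.toLinearEquiv.conjAlgEquiv k (ad k g s)).IsSemisimple
  apply Module.End.isSemisimple_of_squarefree_aeval_eq_zero h.minpoly_squarefree
  rw [Polynomial.aeval_algHom_apply, minpoly.aeval, map_zero]

theorem nil_map (θ : g ≃ₗ⁅k⁆ g) {s : g} (h : IsNilpotent (ad k g s)) :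
    IsNilpotent (ad k g (θ s)) := by
  rw [← LieAlgebra.conj_ad_apply]
  change IsNilpotent (θ.toLinearEquiv.conjAlgEquiv k (ad k g s))
  exact h.map _

theorem ss_smul (c : k) {s : g} (h : (ad k g s).IsSemisimple) :
    (ad k g (c • s)).IsSemisimple := by
  rw [map_smul]
  exact h.of_mem_adjoin_singleton
    (Subalgebra.smul_mem _ (Algebra.self_mem_adjoin_singleton k _) c)

theorem ss_add {x y : g} (hx : (ad k g x).IsSemisimple) (hy : (ad k g y).IsSemisimple)
    (h : ⁅x, y⁆ = 0) : (ad k g (x + y)).IsSemisimple := by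
  rw [map_add]
  exact hx.add_of_commute (commute_ad h) hy

theorem jordan2 (x : g) : ∃ s n : g, x = s + n ∧ (ad k g s).IsSemisimple ∧
    IsNilpotent (ad k g n) ∧ (∀ v : g, ⁅x, v⁆ = 0 → ⁅s, v⁆ = 0) ∧
    (∀ (θ : g ≃ₗ⁅k⁆ g) (ε : k), θ x = ε • x → θ s = ε • s) := by
  obtain ⟨s, n, e, hs, hn, ha⟩ := jordan (k := k) x
  have hcomm : ∀ v : g, ⁅x, v⁆ = 0 → ⁅s, v⁆ = 0 := by
    intro v hv
    apply of_commute_ad (k := k)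
    exact (Algebra.commute_of_mem_adjoin_singleton_of_commute ha (commute_ad hv).symm).symm
  have hsn : ⁅s, n⁆ = 0 := by
    have h1 := hcomm x (lie_self x)
    rw [e, lie_add, lie_self, zero_add] at h1
    exact h1
  have hns : ⁅n, s⁆ = 0 := by rw [← lie_skew, hsn, neg_zero]
  refine ⟨s, n, e, hs, hn, hcomm, ?_⟩
  intro θ ε hθ
  apply ad_inj (k := k)
  refine (Module.End.isNilpotent_isSemisimple_unique (nil_map θ hn) (ss_map θ hs)
    (n₂ := ad k g (ε • n)) (s₂ := ad k g (ε • s)) ?_ (ss_smul ε hs) ?_ ?_ ?_).2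
  · rw [map_smul]; exact hn.smul ε
  · apply commute_ad; rw [← LieEquiv.map_lie, hns, lq_zero]
  · apply commute_ad; simp [hns]
  · rw [← map_add, ← map_add, ← map_add, ← smul_add, add_comm n s, ← e, hθ]

theorem killing_nil {n h : g} (hn : IsNilpotent (ad k g n)) (hc : ⁅n, h⁆ = 0) :
    killingForm k g n h = 0 := by
  rw [killingForm_apply_apply]
  have : IsNilpotent ((ad k g n) ∘ₗ (ad k g h)) :=
    (commute_ad hc).isNilpotent_mul_right hn
  exact (LinearMap.isNilpotent_trace_of_isNilpotent this).eq_zero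

theorem killing_lie (x y z : g) : killingForm k g ⁅x, y⁆ z = killingForm k g x ⁅y, z⁆ :=
  LieModule.traceForm_apply_lie_apply k g g x y z

theorem ss_decomp {x : g} (hx : (ad k g x).IsSemisimple) (v : g) :
    ∃ y z : g, v = ⁅x, y⁆ + z ∧ ⁅x, z⁆ = 0 := by
  refine ss_span (ad k g x) hx (fun v => ∃ y z : g, v = ⁅x, y⁆ + z ∧ ⁅x, z⁆ = 0)
    ⟨0, 0, by simp, by simp⟩ ?_ ?_ v
  · rintro _ _ ⟨y, z, rfl, h⟩ ⟨y', z', rfl, h'⟩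
    exact ⟨y + y', z + z', by rw [lie_add]; abel, by rw [lie_add, h, h', add_zero]⟩
  · intro c v hv
    rw [ad_apply] at hv
    by_cases hc : c = 0
    · exact ⟨0, v, by simp, by rw [hv, hc, zero_smul]⟩
    · exact ⟨c⁻¹ • v, 0, by rw [lie_smul, hv, smul_smul, inv_mul_cancel₀ hc]; simp, by simp⟩

theorem ss_engel {x : g} (hx : (ad k g x).IsSemisimple) {v : g}
    (hv : v ∈ LieSubalgebra.engel k x) : ⁅x, v⁆ = 0 := by
  rw [LieSubalgebra.mem_engel_iff] at hv
  obtain ⟨n, hn⟩ := hv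
  have h1 : v ∈ (ad k g x).maxGenEigenspace 0 := by
    rw [Module.End.mem_maxGenEigenspace]
    exact ⟨n, by simpa using hn⟩
  rw [(Module.End.isFinitelySemisimple_iff_isSemisimple.mpr hx).maxGenEigenspace_eq_eigenspace,
    Module.End.mem_eigenspace_iff] at h1
  simpa using h1

theorem mem_engel_of {x v : g} (n : ℕ) (h : ((ad k g x) ^ n) v = 0) :
    v ∈ LieSubalgebra.engel k x := by
  rw [LieSubalgebra.mem_engel_iff]; exact ⟨n, h⟩

theorem mem_engel_one {x v : g} (h : ⁅x, v⁆ = 0) : v ∈ LieSubalgebra.engel k x :=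
  mem_engel_of 1 (by simpa using h)

theorem mem_engel_two {x v : g} (h : ⁅x, ⁅x, v⁆⁆ = 0) : v ∈ LieSubalgebra.engel k x :=
  mem_engel_of 2 (by simpa [pow_two] using h)

theorem ss_two {x v : g} (hx : (ad k g x).IsSemisimple) (h : ⁅x, ⁅x, v⁆⁆ = 0) : ⁅x, v⁆ = 0 :=
  ss_engel hx (mem_engel_two h)

theorem nondeg {x : g} (hx : (ad k g x).IsSemisimple) {y : g} (hy : ⁅x, y⁆ = 0)
    (h : ∀ z, ⁅x, z⁆ = 0 → killingForm k g y z = 0) : y = 0 := by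
  apply (LieAlgebra.IsKilling.killingForm_nondegenerate k g).1
  intro v
  obtain ⟨w, z, rfl, hz⟩ := ss_decomp hx v
  rw [map_add, h z hz, ← killing_lie, ← lie_skew, hy]
  simp

theorem killing_inv (σ : g ≃ₗ⁅k⁆ g) (hσ : ∀ x, σ (σ x) = x) (x y : g) :
    killingForm k g x (σ y) = killingForm k g (σ x) y := by
  rw [← killingForm_of_equiv_apply σ, hσ]

theorem nondeg1 (σ : g ≃ₗ⁅k⁆ g) (hσ : ∀ x, σ (σ x) = x) {δ : k} (hδ : δ * δ = 1)
    {x : g} (hx : (ad k g x).IsSemisimple) {ε : k} (hε : ε * ε = 1) (hxσ : σ x = ε • x)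
    {y : g} (hyσ : σ y = δ • y) (hy : ⁅x, y⁆ = 0)
    (h : ∀ z, ⁅x, z⁆ = 0 → σ z = δ • z → killingForm k g y z = 0) : y = 0 := by
  apply nondeg hx hy
  intro z hz
  have hz' : ⁅x, σ z⁆ = 0 := by
    have h1 : σ ⁅x, z⁆ = 0 := by rw [hz, lq_zero]
    rw [LieEquiv.map_lie, hxσ, smul_lie] at h1
    have := congrArg (ε • ·) h1
    simpa [smul_smul, hε] using this
  have h2 := h (z + δ • σ z) (by simp [hz, hz']) (by
    have e : σ (z + δ • σ z) = σ z + δ • σ (σ z) := by rw [lq_add, lq_smul]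
    rw [e, hσ, smul_add, smul_smul, hδ, one_smul, add_comm])
  rw [map_add, map_smul, killing_inv σ hσ, hyσ, map_smul, LinearMap.smul_apply, smul_smul, hδ,
    one_smul, ← two_mul] at h2
  exact (mul_eq_zero.mp h2).resolve_left two_ne_zero

theorem nondeg2 (σ τ : g ≃ₗ⁅k⁆ g) (hσ : ∀ x, σ (σ x) = x) (hτ : ∀ x, τ (τ x) = x)
    (hστ : ∀ x, σ (τ x) = τ (σ x)) {δ δ' : k} (hδ : δ * δ = 1) (hδ' : δ' * δ' = 1)
    {x : g} (hx : (ad k g x).IsSemisimple) {ε ε' : k} (hε : ε * ε = 1) (hε' : ε' * ε' = 1)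
    (hxσ : σ x = ε • x) (hxτ : τ x = ε' • x)
    {y : g} (hyσ : σ y = δ • y) (hyτ : τ y = δ' • y) (hy : ⁅x, y⁆ = 0)
    (h : ∀ z, ⁅x, z⁆ = 0 → σ z = δ • z → τ z = δ' • z → killingForm k g y z = 0) : y = 0 := by
  apply nondeg1 σ hσ hδ hx hε hxσ hyσ hy
  intro z hz hzσ
  have hz' : ⁅x, τ z⁆ = 0 := by
    have h1 : τ ⁅x, z⁆ = 0 := by rw [hz, lq_zero]
    rw [LieEquiv.map_lie, hxτ, smul_lie] at h1
    have := congrArg (ε' • ·) h1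
    simpa [smul_smul, hε'] using this
  have e (ρ : g ≃ₗ⁅k⁆ g) : ρ (z + δ' • τ z) = ρ z + δ' • ρ (τ z) := by rw [lq_add, lq_smul]
  have h2 := h (z + δ' • τ z) (by simp [hz, hz']) (by
      rw [e, hστ, hzσ, show τ (δ • z) = δ • τ z from τ.toLinearEquiv.map_smul _ _]
      rw [smul_add, smul_comm]) (by
    rw [e, hτ, smul_add, smul_smul, hδ', one_smul, add_comm])
  rw [map_add, map_smul, killing_inv τ hτ, hyτ, map_smul, LinearMap.smul_apply, smul_smul, hδ',
    one_smul, ← two_mul] at h2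
  exact (mul_eq_zero.mp h2).resolve_left two_ne_zero

end

section
variable {k : Type*} [Field k] [IsAlgClosed k] [CharZero k]
variable {g : Type*} [LieRing g] [LieAlgebra k g] [FiniteDimensional k g]
  [LieAlgebra.IsSemisimple k g]

theorem aux_pair {x y : g} (hx : (ad k g x).IsSemisimple) 
    (hxy : ⁅x, y⁆ = 0) : ∃ t : k, ∀ v : g, ⁅x + t • y, v⁆ = 0 → ⁅x, v⁆ = 0 ∧ ⁅y, v⁆ = 0 := by
  set SA := {μ | (ad k g x).HasEigenvalue μ}
  set SB := {μ | (ad k g y).HasEigenvalue μ}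
  have hA : SA.Finite := Module.End.finite_hasEigenvalue _
  have hB : SB.Finite := Module.End.finite_hasEigenvalue _
  have hbad : ((Set.image2 (fun a b => -(a / b)) SA SB) ∪ {0}).Finite :=
    (hA.image2 _ hB).union (Set.finite_singleton 0)
  obtain ⟨t, ht⟩ := hbad.exists_notMem
  have ht0 : t ≠ 0 := by rintro rfl; exact ht (Or.inr rfl)
  refine ⟨t, ?_⟩
  let W : Submodule k g := LinearMap.ker (ad k g (x + t • y))
  have hW : ∀ v, v ∈ W ↔ ⁅x, v⁆ + t • ⁅y, v⁆ = 0 := by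
    intro v
    simp [W, LinearMap.mem_ker]
  have hinv : W ∈ (ad k g x).invtSubmodule := by
    intro v hv
    rw [hW] at hv
    change ⁅x, v⁆ ∈ W
    rw [hW]
    have h1 : ⁅y, ⁅x, v⁆⁆ = ⁅x, ⁅y, v⁆⁆ := by
      rw [leibniz_lie x y v, hxy, zero_lie, zero_add]
    rw [h1, ← lie_smul, ← lie_add, hv, lie_zero]
  have hss := hx.restrict hinv
  have key : ∀ v ∈ W, ⁅x, v⁆ = 0 := by
    intro v hv
    refine ss_span _ hss (fun w : W => ⁅x, (w : g)⁆ = 0) (by simp) ?_ ?_ ⟨v, hv⟩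
    · intro a b ha hb
      simp [ha, hb]
    · intro c w hw
      have hw1 : ⁅x, (w : g)⁆ = c • (w : g) := congrArg Subtype.val hw
      by_cases hw0 : (w : g) = 0
      · simp [hw0]
      by_cases hc : c = 0
      · rw [hw1, hc, zero_smul]
      exfalso
      apply ht
      left
      have hw2 := (hW w).mp w.2
      rw [hw1] at hw2
      have hw3 : ⁅y, (w : g)⁆ = (-(c / t)) • (w : g) := by
        have : t • ⁅y, (w : g)⁆ = (-c) • (w : g) := by
          rw [neg_smul]; exact eq_neg_of_add_eq_zero_right hw2
        have h4 := congrArg (t⁻¹ • ·) this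
        simp only [smul_smul, inv_mul_cancel₀ ht0, one_smul] at h4
        rw [h4]; congr 1; field_simp
      refine ⟨c, ?_, -(c / t), ?_, ?_⟩
      · exact Module.End.hasEigenvalue_of_hasEigenvector
          (Module.End.hasEigenvector_iff.mpr ⟨Module.End.mem_eigenspace_iff.mpr hw1, hw0⟩)
      · exact Module.End.hasEigenvalue_of_hasEigenvector
          (Module.End.hasEigenvector_iff.mpr ⟨Module.End.mem_eigenspace_iff.mpr hw3, hw0⟩)
      · field_simp
  intro v hv
  have hvW : v ∈ W := hv
  have h1 := key v hvW
  have h2 := (hW v).mp hvW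
  rw [h1, zero_add] at h2
  exact ⟨h1, (smul_eq_zero.mp h2).resolve_left ht0⟩

theorem lemma_G (c : Submodule k g) (hss : ∀ x ∈ c, (ad k g x).IsSemisimple)
    (hab : ∀ x ∈ c, ∀ y ∈ c, ⁅x, y⁆ = 0) :
    ∃ x ∈ c, ∀ v : g, ⁅x, v⁆ = 0 → ∀ y ∈ c, ⁅y, v⁆ = 0 := by
  have hne : ((fun x => finrank k (LinearMap.ker (ad k g x))) '' (c : Set g)).Nonempty :=
    ⟨_, 0, c.zero_mem, rfl⟩
  obtain ⟨x, hx, hmin⟩ := Nat.sInf_mem hne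
  have hmin' : ∀ z ∈ c, finrank k (LinearMap.ker (ad k g x)) ≤
      finrank k (LinearMap.ker (ad k g z)) := by
    intro z hz
    dsimp only at hmin
    rw [hmin]
    exact Nat.sInf_le ⟨z, hz, rfl⟩
  refine ⟨x, hx, ?_⟩
  intro v hv y hy
  obtain ⟨t, ht⟩ := aux_pair (k := k) (hss x hx) (hab x hx y hy)
  have hle : LinearMap.ker (ad k g (x + t • y)) ≤ LinearMap.ker (ad k g x) :=
    fun w hw => (ht w hw).1
  have heq := Submodule.eq_of_le_of_finrank_le hle
    (hmin' _ (c.add_mem hx (c.smul_mem t hy)))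
  have hv' : v ∈ LinearMap.ker (ad k g (x + t • y)) := by rw [heq]; exact hv
  exact (ht v hv').2

theorem reg_cartan {y : g} (hy : LieAlgebra.IsRegular k y) :
    (LieSubalgebra.engel k y).IsCartanSubalgebra := by
  have hcard : (finrank k g : Cardinal) ≤ Cardinal.mk k :=
    Cardinal.natCast_le_aleph0.trans <| Cardinal.infinite_iff.mp inferInstance
  refine ⟨?_, LieSubalgebra.normalizer_engel _ _⟩
  apply LieSubalgebra.isNilpotent_of_forall_le_engel
  intro z hz
  set Ex : {LieSubalgebra.engel k z | z ∈ LieSubalgebra.engel k y} :=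
    ⟨LieSubalgebra.engel k y, y, LieSubalgebra.self_mem_engel k y, rfl⟩
  suffices IsBot Ex from @this ⟨LieSubalgebra.engel k z, z, hz, rfl⟩
  apply engel_isBot_of_isMin hcard (LieSubalgebra.engel k y) Ex le_rfl
  rintro ⟨_, w, hw, rfl⟩ hyx
  suffices finrank k (LieSubalgebra.engel k y) ≤ finrank k (LieSubalgebra.engel k w) by
    suffices LieSubalgebra.engel k w = LieSubalgebra.engel k y from this.ge
    apply LieSubalgebra.toSubmodule_injective
    exact Submodule.eq_of_le_of_finrank_le hyx this
  rw [(isRegular_iff_finrank_engel_eq_rank k y).mp hy]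
  apply rank_le_finrank_engel

theorem cartan_ss {H : LieSubalgebra k g} (hH : H.IsCartanSubalgebra) {x : g} (hx : x ∈ H) :
    (ad k g x).IsSemisimple :=
  LieAlgebra.IsKilling.isSemisimple_ad_of_mem_isCartanSubalgebra hx

theorem cartan_ab {H : LieSubalgebra k g} (hH : H.IsCartanSubalgebra) {x y : g} (hx : x ∈ H)
    (hy : y ∈ H) : ⁅x, y⁆ = 0 := by
  have := LieAlgebra.IsKilling.instIsLieAbelianOfIsCartanSubalgebra k g H
  have h1 := trivial_lie_zero H H ⟨x, hx⟩ ⟨y, hy⟩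
  exact congrArg Subtype.val h1

theorem cartan_max {H : LieSubalgebra k g} (hH : H.IsCartanSubalgebra) {x : g}
    (hx : ∀ y ∈ H, ⁅y, x⁆ = 0) : x ∈ H := by
  rw [← hH.self_normalizing, LieSubalgebra.mem_normalizer_iff']
  intro y hy
  rw [hx y hy]; exact H.zero_mem

theorem reg_ss {y : g} (hy : LieAlgebra.IsRegular k y) : (ad k g y).IsSemisimple :=
  cartan_ss (reg_cartan hy) (LieSubalgebra.self_mem_engel k y)

theorem cartan_gen {H : LieSubalgebra k g} (hH : H.IsCartanSubalgebra) :
    finrank k H = rank k g ∧ ∃ h ∈ H, LieAlgebra.IsRegular k h ∧ (∀ v : g, ⁅h, v⁆ = 0 ↔ v ∈ H) := by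
  obtain ⟨h, hh, hg⟩ := lemma_G H.toSubmodule (fun x hx => cartan_ss hH hx)
    (fun x hx y hy => cartan_ab hH hx hy)
  have hz : ∀ v : g, ⁅h, v⁆ = 0 ↔ v ∈ H := fun v =>
    ⟨fun hv => cartan_max hH (hg v hv), fun hv => cartan_ab hH hh hv⟩
  have hen : LieSubalgebra.engel k h = H := by
    ext v
    exact ⟨fun hv => (hz v).mp (ss_engel (cartan_ss hH hh) hv),
      fun hv => mem_engel_one ((hz v).mpr hv)⟩
  obtain ⟨h', hh', hr⟩ := lemma_T ⊤ H.toSubmodule ⊤ le_top (fun _ _ _ _ => trivial) h hh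
    (fun v _ => by
      obtain ⟨y, z, e, hzz⟩ := ss_decomp (cartan_ss hH hh) v
      exact ⟨y, trivial, z, (hz z).mp hzz, e⟩)
    (by
      obtain ⟨x, hx⟩ := LieAlgebra.exists_isRegular k g
      exact ⟨x, trivial, hx⟩)
  have h1 : finrank k H ≤ rank k g := by
    rw [← (isRegular_iff_finrank_engel_eq_rank k h').mp hr]
    apply Submodule.finrank_mono (R := k) (s := H.toSubmodule)
    intro v hv
    exact mem_engel_one (cartan_ab hH hh' hv)
  have h2 := rank_le_finrank_engel k h
  rw [hen] at h2
  have h3 := le_antisymm h1 h2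
  refine ⟨h3, h, hh, ?_, hz⟩
  rw [isRegular_iff_finrank_engel_eq_rank, hen, h3]

end

section
variable {k : Type*} [Field k] [IsAlgClosed k] [CharZero k]
variable {g : Type*} [LieRing g] [LieAlgebra k g] [FiniteDimensional k g]
  [LieAlgebra.IsSemisimple k g]

theorem mem_eigp (σ : g ≃ₗ⁅k⁆ g) (x : g) : x ∈ eigSub k g σ 1 ↔ σ x = x := by
  have : x ∈ eigSub k g σ 1 ↔ σ x = (1 : k) • x := Module.End.mem_eigenspace_iff
  rw [this, one_smul]

theorem mem_eigm (σ : g ≃ₗ⁅k⁆ g) (x : g) : x ∈ eigSub k g σ (-1) ↔ σ x = -x := by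
  have : x ∈ eigSub k g σ (-1) ↔ σ x = (-1 : k) • x := Module.End.mem_eigenspace_iff
  rw [this, neg_smul, one_smul]

theorem lq_neg (θ : g ≃ₗ⁅k⁆ g) (x : g) : θ (-x) = -θ x := θ.toLieHom.map_neg x
theorem lq_sub (θ : g ≃ₗ⁅k⁆ g) (x y : g) : θ (x - y) = θ x - θ y := θ.toLieHom.map_sub x y

theorem self_neg {k : Type*} [Field k] [CharZero k] {g : Type*} [AddCommGroup g] [Module k g]
    {x : g} (h : x = -x) : x = 0 := by
  have h2 : (2 : k) • x = 0 := by rw [two_smul]; nth_rewrite 1 [h]; simp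
  exact (smul_eq_zero.mp h2).resolve_left two_ne_zero

theorem half_add (x y : g) : x = (2⁻¹ : k) • (x + y) + (2⁻¹ : k) • (x - y) := by
  rw [← smul_add, add_add_sub_cancel, ← two_smul k x, smul_smul, inv_mul_cancel₀ two_ne_zero,
    one_smul]

theorem ker_inv (σ : g ≃ₗ⁅k⁆ g) {x y : g} (hx : σ x = x ∨ σ x = -x) (h : ⁅x, y⁆ = 0) :
    ⁅x, σ y⁆ = 0 := by
  have h1 : σ ⁅x, y⁆ = 0 := by rw [h, lq_zero]
  rw [LieEquiv.map_lie] at h1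
  rcases hx with hx | hx
  · rwa [hx] at h1
  · rw [hx, neg_lie, neg_eq_zero] at h1; exact h1

theorem lemma_D (σ : g ≃ₗ⁅k⁆ g) (hmax : IsMaxRank k g σ) {y : g}
    (hy : LieAlgebra.IsRegular k y) (hyσ : σ y = -y) {z : g}
    (hz : z ∈ LieSubalgebra.engel k y) : σ z = -z := by
  obtain ⟨H, hH, hH1⟩ := hmax
  obtain ⟨hr, h, hh, -, hker⟩ := cartan_gen hH
  have hhσ := (mem_eigm σ h).mp (hH1 hh)
  set G0 := eigSub k g σ 1 with hG0
  set G1 := eigSub k g σ (-1) with hG1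
  have hinj : Disjoint G0 (LinearMap.ker (ad k g h)) := by
    rw [Submodule.disjoint_def]
    intro v hv hv2
    have h1 := (mem_eigm σ v).mp (hH1 ((hker v).mp hv2))
    rw [(mem_eigp σ v).mp hv] at h1
    exact self_neg (k := k) h1
  have e1 : finrank k (G0.map (ad k g h)) = finrank k G0 := by
    have hi : Function.Injective ((ad k g h).domRestrict G0) := by
      rw [← LinearMap.ker_eq_bot, LinearMap.ker_eq_bot']
      intro m hm
      have := Submodule.disjoint_def.mp hinj m m.2 hm
      exact Subtype.ext this
    have := LinearMap.finrank_range_of_inj hi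
    rw [← this, LinearMap.range_domRestrict]
  have hdis : Disjoint (G0.map (ad k g h)) H.toSubmodule := by
    rw [Submodule.disjoint_def]
    rintro _ ⟨v, hv, rfl⟩ hv2
    exact ss_two (k := k) (cartan_ss hH hh) ((hker _).mpr hv2)
  have hle : G0.map (ad k g h) ⊔ H.toSubmodule ≤ G1 := by
    refine sup_le ?_ hH1
    rintro _ ⟨v, hv, rfl⟩
    rw [hG1, mem_eigm, ad_apply, LieEquiv.map_lie, hhσ, (mem_eigp σ v).mp hv, neg_lie]
  have e2 : finrank k G0 + rank k g ≤ finrank k G1 := by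
    have h2 := Submodule.finrank_sup_add_finrank_inf_eq (G0.map (ad k g h)) H.toSubmodule
    rw [hdis.eq_bot, finrank_bot] at h2
    have h3 := Submodule.finrank_mono hle
    have h4 : finrank k H.toSubmodule = rank k g := hr
    omega
  have e3 := LinearMap.finrank_range_add_finrank_ker ((ad k g y).domRestrict G1)
  rw [LinearMap.range_domRestrict] at e3
  have e4 : finrank k (G1.map (ad k g y)) ≤ finrank k G0 := by
    apply Submodule.finrank_mono
    rintro _ ⟨v, hv, rfl⟩
    rw [hG0, mem_eigp, ad_apply, LieEquiv.map_lie, hyσ, (mem_eigm σ v).mp hv, neg_lie, lie_neg,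
      neg_neg]
  set N := (LinearMap.ker ((ad k g y).domRestrict G1)).map G1.subtype with hN
  have e5 : finrank k N = finrank k (LinearMap.ker ((ad k g y).domRestrict G1)) :=
    Submodule.finrank_map_subtype_eq _ _
  have hNG : N ≤ G1 := Submodule.map_subtype_le _ _
  have hNe : N ≤ (LieSubalgebra.engel k y).toSubmodule := by
    rintro _ ⟨v, hv, rfl⟩
    exact mem_engel_one hv
  have e6 : finrank k (LieSubalgebra.engel k y).toSubmodule = rank k g :=
    (isRegular_iff_finrank_engel_eq_rank k y).mp hy
  have e7 := Submodule.eq_of_le_of_finrank_le hNe (by omega)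
  have hz' : z ∈ N := by rw [e7]; exact hz
  exact (mem_eigm σ z).mp (hNG hz')

theorem lemma_W (σ : g ≃ₗ⁅k⁆ g) (hσ : ∀ x, σ (σ x) = x)
    (hreg : ∃ v, σ v = -v ∧ LieAlgebra.IsRegular k v) {x : g} (hx : (ad k g x).IsSemisimple)
    (hxσ : σ x = -x) : ∃ y, LieAlgebra.IsRegular k y ∧ ⁅x, y⁆ = 0 ∧ σ y = -y := by
  obtain ⟨y, hy, hyr⟩ := lemma_T (eigSub k g σ (-1)) (eigSub k g σ (-1) ⊓ LinearMap.ker (ad k g x))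
    (eigSub k g σ 1) inf_le_left (by
      intro y hy v hv
      rw [mem_eigm] at hv ⊢
      rw [mem_eigp] at hy
      rw [LieEquiv.map_lie, hy, hv, lie_neg]) x
    ⟨(mem_eigm σ x).mpr hxσ, lie_self x⟩ (by
      intro v hv
      rw [mem_eigm] at hv
      obtain ⟨y, z, e, hz⟩ := ss_decomp hx v
      have hz' := ker_inv σ (Or.inr hxσ) hz
      have e' : v = ⁅x, σ y⁆ - σ z := by
        have h1 : -v = σ (⁅x, y⁆ + z) := by rw [← e, hv]
        rw [lq_add, LieEquiv.map_lie, hxσ, neg_lie] at h1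
        rw [← neg_neg v, h1]; abel
      refine ⟨(2⁻¹ : k) • (y + σ y), ?_, (2⁻¹ : k) • (z - σ z), ⟨?_, ?_⟩, ?_⟩
      · rw [mem_eigp, lq_smul, lq_add, hσ, add_comm]
      · refine (mem_eigm σ _).mpr ?_
        rw [lq_smul, lq_sub, hσ, ← smul_neg, neg_sub]
      · refine LinearMap.mem_ker.mpr ?_
        rw [ad_apply, lie_smul, lie_sub, hz, hz', sub_zero, smul_zero]
      · have : (2 : k) • v = ⁅x, y + σ y⁆ + (z - σ z) := by
          rw [two_smul]; nth_rewrite 1 [e]; rw [e', lie_add]; abel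
        rw [lie_smul, ← smul_add, ← this, smul_smul, inv_mul_cancel₀ two_ne_zero, one_smul])
    (by
      obtain ⟨v, hv, hvr⟩ := hreg
      exact ⟨v, (mem_eigm σ v).mpr hv, hvr⟩)
  exact ⟨y, hyr, hy.2, (mem_eigm σ y).mp hy.1⟩

theorem max_reg {σ : g ≃ₗ⁅k⁆ g} (hmax : IsMaxRank k g σ) :
    ∃ v, σ v = -v ∧ LieAlgebra.IsRegular k v := by
  obtain ⟨H, hH, hH1⟩ := hmax
  obtain ⟨hr, h, hh, h2, hker⟩ := cartan_gen hH
  exact ⟨h, (mem_eigm σ h).mp (hH1 hh), h2⟩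

theorem lie_zero_two {x a b : g} (ha : ⁅x, a⁆ = 0) (hb : ⁅x, b⁆ = 0) : ⁅x, ⁅a, b⁆⁆ = 0 := by
  rw [leibniz_lie, ha, hb]; simp

theorem lie_zero_symm {a b : g} (h : ⁅a, b⁆ = 0) : ⁅b, a⁆ = 0 := by
  rw [← lie_skew, h, neg_zero]

theorem lemma_C (θ θ' : g ≃ₗ⁅k⁆ g) (hcomm : CommutingInvolutions k g θ θ')
    (hmax : IsMaxRank k g θ') (c : Submodule k g) (hc : ∀ x ∈ c, θ x = x ∧ θ' x = -x)
    {x : g} (hxc : x ∈ c) (hx : (ad k g x).IsSemisimple)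
    (hgen : ∀ v : g, ⁅x, v⁆ = 0 → ∀ y ∈ c, ⁅y, v⁆ = 0)
    (hl : ∀ v : g, ⁅x, v⁆ = 0 → θ v = v → θ' v = -v → v ∈ c)
    {z : g} (hxz : ⁅x, z⁆ = 0) (hz : θ z = -z) (hz' : θ' z = z) : z = 0 := by
  obtain ⟨i1, i2, i3⟩ := hcomm
  obtain ⟨hx1, hx2⟩ := hc x hxc
  obtain ⟨y, hyr, hxy, hyθ⟩ := lemma_W θ' i2 (max_reg hmax) hx hx2
  have hxy' := ker_inv θ (Or.inl hx1) hxy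
  have hy1 : (2⁻¹ : k) • (y + θ y) ∈ c := by
    apply hl
    · rw [lie_smul, lie_add, hxy, hxy', add_zero, smul_zero]
    · rw [lq_smul, lq_add, i1, add_comm]
    · rw [lq_smul, lq_add, ← i3, hyθ, lq_neg, ← smul_neg, neg_add]
  set y2 := (2⁻¹ : k) • (y - θ y) with hy2
  have h1 : ⁅x, y2⁆ = 0 := by rw [hy2, lie_smul, lie_sub, hxy, hxy', sub_zero, smul_zero]
  have h2 : θ y2 = -y2 := by rw [hy2, lq_smul, lq_sub, i1, ← smul_neg, neg_sub]
  have h3 : θ' y2 = -y2 := by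
    rw [hy2, lq_smul, lq_sub, ← i3, hyθ, lq_neg, ← smul_neg, neg_sub, sub_neg_eq_add, neg_add_eq_sub]
  have hw1 : θ ⁅y2, z⁆ = ⁅y2, z⁆ := by rw [LieEquiv.map_lie, h2, hz, neg_lie, lie_neg, neg_neg]
  have hw2 : θ' ⁅y2, z⁆ = -⁅y2, z⁆ := by rw [LieEquiv.map_lie, h3, hz', neg_lie]
  have hw3 : ⁅x, ⁅y2, z⁆⁆ = 0 := lie_zero_two h1 hxz
  have hw : ⁅y2, z⁆ = 0 := by
    refine nondeg2 θ θ' i1 i2 i3 (δ := (1 : k)) (δ' := -1) (ε := 1) (ε' := -1) (by simp) (by simp)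
      hx (by simp) (by simp) (by simpa using hx1) (by simpa using hx2) (by simpa using hw1)
      (by simpa using hw2) hw3 ?_
    intro d hd hd1 hd2
    have hdc := hl d hd (by simpa using hd1) (by simpa using hd2)
    rw [killing_lie, lie_zero_symm (hgen z hxz d hdc), map_zero]
  have hyz : ⁅y, z⁆ = 0 := by
    rw [half_add (k := k) y (θ y), add_lie, hw, hgen z hxz _ hy1, add_zero]
  have := lemma_D θ' hmax hyr hyθ (mem_engel_one hyz)
  rw [hz'] at this
  exact self_neg (k := k) this

end

section
variable {k : Type*} [Field k] [IsAlgClosed k] [CharZero k]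
variable {g : Type*} [LieRing g] [LieAlgebra k g] [FiniteDimensional k g]
  [LieAlgebra.IsSemisimple k g]

theorem step1 (θ θ' : g ≃ₗ⁅k⁆ g) (hcomm : CommutingInvolutions k g θ θ')
    (hmax : IsMaxRank k g θ') (hreg : ∃ v, θ (θ' v) = -v ∧ LieAlgebra.IsRegular k v) :
    ∃ y, LieAlgebra.IsRegular k y ∧ θ y = y ∧ θ' y = -y := by
  have hcomm' := hcomm
  obtain ⟨i1, i2, i3⟩ := hcomm
  let P : Set (Submodule k g) := {c | (∀ x ∈ c, θ x = x ∧ θ' x = -x) ∧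
    (∀ x ∈ c, (ad k g x).IsSemisimple) ∧ (∀ x ∈ c, ∀ y ∈ c, ⁅x, y⁆ = 0)}
  have hP0 : (⊥ : Submodule k g) ∈ P := by
    refine ⟨?_, ?_, ?_⟩
    · intro x hx
      rw [Submodule.mem_bot] at hx
      subst hx
      simp [lq_zero]
    · intro x hx
      rw [Submodule.mem_bot] at hx
      subst hx
      rw [map_zero]
      exact Module.End.isSemisimple_zero
    · intro x hx y hy
      rw [Submodule.mem_bot] at hx
      subst hx
      simp
  obtain ⟨c, hcP, hcmax⟩ :=
    (wellFounded_gt : WellFounded ((· > ·) : Submodule k g → Submodule k g → Prop)).has_min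
      P ⟨⊥, hP0⟩
  obtain ⟨hc, hss, hab⟩ := hcP
  obtain ⟨x, hxc, hgen⟩ := lemma_G c hss hab
  have hx := hss x hxc
  obtain ⟨hx1, hx2⟩ := hc x hxc
  -- Jordan parts of elements of l01
  have hJ : ∀ y : g, ⁅x, y⁆ = 0 → θ y = y → θ' y = -y → ∃ s n : g, y = s + n ∧ s ∈ c ∧
      IsNilpotent (ad k g n) ∧ ⁅x, n⁆ = 0 ∧ θ n = n ∧ θ' n = -n := by
    intro y hxy hy1 hy2
    obtain ⟨s, n, e, hs, hn, hcs, hθs⟩ := jordan2 (k := k) y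
    have hxs : ⁅x, s⁆ = 0 := lie_zero_symm (hcs x (lie_zero_symm hxy))
    have hs1 : θ s = s := by simpa using hθs θ 1 (by simpa using hy1)
    have hs2 : θ' s = -s := by simpa using hθs θ' (-1) (by simpa using hy2)
    have hen : n = y - s := by rw [e]; abel
    have hsc : s ∈ c := by
      have hQ : c ⊔ Submodule.span k {s} ∈ P := by
        have hmem : ∀ v ∈ c ⊔ Submodule.span k {s}, ∃ a ∈ c, ∃ t : k, v = a + t • s := by
          intro v hv
          obtain ⟨a, ha, b, hb, rfl⟩ := Submodule.mem_sup.mp hv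
          obtain ⟨t, rfl⟩ := Submodule.mem_span_singleton.mp hb
          exact ⟨a, ha, t, rfl⟩
        refine ⟨?_, ?_, ?_⟩
        · intro v hv
          obtain ⟨a, ha, t, rfl⟩ := hmem v hv
          rw [lq_add, lq_add, lq_smul, lq_smul, hs1, hs2, (hc a ha).1, (hc a ha).2]
          exact ⟨rfl, by rw [smul_neg, neg_add]⟩
        · intro v hv
          obtain ⟨a, ha, t, rfl⟩ := hmem v hv
          exact ss_add (hss a ha) (ss_smul t hs) (by rw [lie_smul, hgen s hxs a ha, smul_zero])
        · intro v hv w hw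
          obtain ⟨a, ha, t, rfl⟩ := hmem v hv
          obtain ⟨b, hb, u, rfl⟩ := hmem w hw
          simp [hab a ha b hb, hgen s hxs a ha, lie_zero_symm (hgen s hxs b hb)]
      have hnot := hcmax _ hQ
      have hle : c ≤ c ⊔ Submodule.span k {s} := le_sup_left
      have heq : c = c ⊔ Submodule.span k {s} := by
        by_contra hne
        exact hnot (lt_of_le_of_ne hle hne)
      rw [heq]
      exact Submodule.mem_sup_right (Submodule.mem_span_singleton_self s)
    refine ⟨s, n, e, hsc, hn, ?_, ?_, ?_⟩
    · rw [hen, lie_sub, hxy, hxs, sub_zero]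
    · rw [hen, lq_sub, hy1, hs1]
    · rw [hen, lq_sub, hy2, hs2]; abel
  have hnd : ∀ y : g, ⁅x, y⁆ = 0 → θ y = y → θ' y = -y →
      (∀ z : g, ⁅x, z⁆ = 0 → θ z = z → θ' z = -z → killingForm k g y z = 0) → y = 0 := by
    intro y hy hy1 hy2 h
    refine nondeg2 θ θ' i1 i2 i3 (δ := (1 : k)) (δ' := -1) (ε := 1) (ε' := -1) (by simp) (by simp)
      hx (by simp) (by simp) (by simpa using hx1) (by simpa using hx2) (by simpa using hy1)
      (by simpa using hy2) hy ?_
    intro z hz hz1 hz2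
    exact h z hz (by simpa using hz1) (by simpa using hz2)
  have hsym : ∀ a b : g, killingForm k g a b = killingForm k g b a :=
    fun a b => LieModule.traceForm_comm k g g a b
  have hcn : ∀ d ∈ c, (∀ d' ∈ c, killingForm k g d d' = 0) → d = 0 := by
    intro d hd h
    refine hnd d (hab x hxc d hd) (hc d hd).1 (hc d hd).2 ?_
    intro z hz hz1 hz2
    obtain ⟨s, n, e, hs, hn, hxn, -, -⟩ := hJ z hz hz1 hz2
    rw [e, map_add, h s hs, hsym d n, killing_nil hn (lie_zero_symm (hgen n hxn d hd)), add_zero]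
  have hN : ∀ v : g, ⁅x, v⁆ = 0 → θ v = v → θ' v = -v → (∀ d ∈ c, killingForm k g v d = 0) →
      killingForm k g v v = 0 := by
    intro v hv hv1 hv2 h
    obtain ⟨s, n, e, hs, hn, hxn, -, -⟩ := hJ v hv hv1 hv2
    have hs0 : s = 0 := by
      apply hcn s hs
      intro d hd
      have h1 := h d hd
      rw [e, map_add, LinearMap.add_apply, killing_nil hn (lie_zero_symm (hgen n hxn d hd)),
        add_zero] at h1
      exact h1
    rw [hs0, zero_add] at e
    rw [e]
    exact killing_nil hn (lie_self n)
  have hl : ∀ v : g, ⁅x, v⁆ = 0 → θ v = v → θ' v = -v → v ∈ c := by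
    intro v hv hv1 hv2
    obtain ⟨s, n, e, hs, hn, hxn, hn1, hn2⟩ := hJ v hv hv1 hv2
    have hn0 : n = 0 := by
      apply hnd n hxn hn1 hn2
      intro z hz hz1 hz2
      obtain ⟨s', n', e', hs', hn', hxn', hn1', hn2'⟩ := hJ z hz hz1 hz2
      have a1 : ∀ d ∈ c, killingForm k g n d = 0 := fun d hd =>
        killing_nil hn (lie_zero_symm (hgen n hxn d hd))
      have a2 : ∀ d ∈ c, killingForm k g n' d = 0 := fun d hd =>
        killing_nil hn' (lie_zero_symm (hgen n' hxn' d hd))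
      have b1 := hN n hxn hn1 hn2 a1
      have b2 := hN n' hxn' hn1' hn2' a2
      have b3 := hN (n + n') (by rw [lie_add, hxn, hxn', add_zero]) (by rw [lq_add, hn1, hn1'])
        (by rw [lq_add, hn2, hn2', neg_add]) (fun d hd => by
          rw [map_add, LinearMap.add_apply, a1 d hd, a2 d hd, add_zero])
      rw [map_add, map_add, LinearMap.add_apply, LinearMap.add_apply, b1, b2, hsym n' n, zero_add,
        add_zero, ← two_mul] at b3
      rw [e', map_add, a1 s' hs', (mul_eq_zero.mp b3).resolve_left two_ne_zero, add_zero]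
    rw [e, hn0, add_zero]; exact hs
  obtain ⟨y, hyr, hxy, hyσ⟩ := lemma_W (θ'.trans θ) (fun v => by
      change θ (θ' (θ (θ' v))) = v
      rw [← i3 (θ' v), i2, i1]) hreg hx (by
      change θ (θ' x) = -x
      rw [hx2, lq_neg, hx1])
  have hyσ' : θ (θ' y) = -y := hyσ
  have hθ'y : θ' y = - θ y := by rw [← i1 (θ' y), hyσ', lq_neg]
  have hxy' := ker_inv θ (Or.inl hx1) hxy
  have h20 : y - θ y = 0 := by
    apply lemma_C θ θ' hcomm' hmax c hc hxc hx hgen hl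
    · rw [lie_sub, hxy, hxy', sub_zero]
    · rw [lq_sub, i1, neg_sub]
    · rw [lq_sub, ← i3, hyσ', hθ'y]; abel
  have hyy : θ y = y := (sub_eq_zero.mp h20).symm
  exact ⟨y, hyr, hyy, by rw [hθ'y, hyy]⟩

theorem step2 (θ θ' : g ≃ₗ⁅k⁆ g) (hmax : IsMaxRank k g θ') {y : g}
    (hy : LieAlgebra.IsRegular k y) (hy1 : θ y = y) (hy2 : θ' y = -y) :
    ∃ H : LieSubalgebra k (fixSubalgebra k g θ), H.IsCartanSubalgebra ∧
        ∀ y ∈ H, θ (y : g) = y ∧ θ' (y : g) = - (y : g) := by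
  have hC := reg_cartan hy
  let H : LieSubalgebra k (fixSubalgebra k g θ) :=
    (LieSubalgebra.engel k y).comap (fixSubalgebra k g θ).incl
  have hH : ∀ v, v ∈ H ↔ (v : g) ∈ LieSubalgebra.engel k y := fun v => Iff.rfl
  have hab : IsLieAbelian H := by
    constructor
    intro a b
    apply Subtype.ext
    apply Subtype.ext
    exact cartan_ab hC ((hH a).mp a.2) ((hH b).mp b.2)
  refine ⟨H, ⟨inferInstance, ?_⟩, ?_⟩
  · apply le_antisymm _ (LieSubalgebra.le_normalizer H)
    intro z hz
    rw [LieSubalgebra.mem_normalizer_iff'] at hz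
    have h1 := hz ⟨y, hy1⟩ ((hH _).mpr (LieSubalgebra.self_mem_engel k y))
    rw [hH] at h1 ⊢
    have h2 := cartan_ab hC (LieSubalgebra.self_mem_engel k y) h1
    exact mem_engel_two h2
  · intro v hv
    exact ⟨v.2, lemma_D θ' hmax hy hy2 ((hH v).mp hv)⟩

theorem step3 (θ θ' : g ≃ₗ⁅k⁆ g) (hcomm : CommutingInvolutions k g θ θ')
    (hmax : IsMaxRank k g θ') (H : LieSubalgebra k (fixSubalgebra k g θ))
    (hH : H.IsCartanSubalgebra) (hH2 : ∀ y ∈ H, θ' (y : g) = - (y : g)) :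
    ∃ y, LieAlgebra.IsRegular k y ∧ θ y = y ∧ θ' y = -y := by
  have hcomm' := hcomm
  obtain ⟨i1, i2, i3⟩ := hcomm
  let HH : Submodule k g := H.toSubmodule.map (fixSubalgebra k g θ).toSubmodule.subtype
  have hmem : ∀ v : g, v ∈ HH ↔ ∃ h ∈ H, (h : g) = v := fun v => Iff.rfl
  have f1 : ∀ v ∈ HH, θ v = v ∧ θ' v = -v := by
    rintro _ ⟨h, hh, rfl⟩
    exact ⟨h.2, hH2 h hh⟩
  have f2 : ∀ a ∈ HH, ∀ b ∈ HH, ⁅a, b⁆ = 0 := by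
    intro a ha b hb
    have h1 : ⁅a, b⁆ ∈ HH := by
      obtain ⟨a, ha, rfl⟩ := ha
      obtain ⟨b, hb, rfl⟩ := hb
      exact ⟨(⁅(show fixSubalgebra k g θ from a), (show fixSubalgebra k g θ from b)⁆ :
        fixSubalgebra k g θ), H.lie_mem ha hb, rfl⟩
    have h2 := (f1 _ h1).2
    rw [LieEquiv.map_lie, (f1 a ha).2, (f1 b hb).2, neg_lie, lie_neg, neg_neg] at h2
    exact self_neg (k := k) h2
  have f4 : ∀ v : g, θ v = v → (∀ a ∈ HH, ∃ n : ℕ, ((ad k g a) ^ n) v = 0) → v ∈ HH := by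
    intro v hv h
    have hz : (⟨v, hv⟩ : fixSubalgebra k g θ) ∈ zeroRootSubalgebra k (fixSubalgebra k g θ) H := by
      rw [mem_zeroRootSubalgebra]
      intro y
      obtain ⟨n, hn⟩ := h (y : fixSubalgebra k g θ) ⟨y, y.2, rfl⟩
      refine ⟨n, ?_⟩
      apply Subtype.ext
      have key : ∀ m : ℕ, ((((LieModule.toEnd k H (fixSubalgebra k g θ) y) ^ m) ⟨v, hv⟩ :
          fixSubalgebra k g θ) : g) = ((ad k g ((y : fixSubalgebra k g θ) : g)) ^ m) v := by
        intro m
        induction m with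
        | zero => rfl
        | succ m ih =>
          rw [pow_succ', pow_succ', Module.End.mul_apply, Module.End.mul_apply, ← ih]
          rfl
      rw [key, hn]; rfl
    rw [LieAlgebra.zeroRootSubalgebra_eq_of_is_cartan] at hz
    exact ⟨_, hz, rfl⟩
  have f3 : ∀ v : g, θ v = v → (∀ a ∈ HH, ⁅a, v⁆ = 0) → v ∈ HH := by
    intro v hv h
    exact f4 v hv (fun a ha => ⟨1, by simpa using h a ha⟩)
  let c : Submodule k g :=
    { carrier := {v | v ∈ HH ∧ (ad k g v).IsSemisimple}
      add_mem' := fun {a b} ha hb => ⟨HH.add_mem ha.1 hb.1, ss_add ha.2 hb.2 (f2 a ha.1 b hb.1)⟩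
      zero_mem' := ⟨HH.zero_mem, by rw [map_zero]; exact Module.End.isSemisimple_zero⟩
      smul_mem' := fun t a ha => ⟨HH.smul_mem t ha.1, ss_smul t ha.2⟩ }
  have hcm : ∀ v, v ∈ c ↔ v ∈ HH ∧ (ad k g v).IsSemisimple := fun v => Iff.rfl
  obtain ⟨x, hxc, hgen⟩ := lemma_G c (fun v hv => hv.2) (fun a ha b hb => f2 a ha.1 b hb.1)
  have hx : (ad k g x).IsSemisimple := hxc.2
  have hxH : x ∈ HH := hxc.1
  obtain ⟨hx1, hx2⟩ := f1 x hxH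
  have hJ : ∀ a ∈ HH, ∃ s n : g, a = s + n ∧ s ∈ c ∧ n ∈ HH ∧ IsNilpotent (ad k g n) := by
    intro a ha
    obtain ⟨s, n, e, hs, hn, hcs, hθs⟩ := jordan2 (k := k) a
    have hs1 : θ s = s := by simpa using hθs θ 1 (by simpa using (f1 a ha).1)
    have hsH : s ∈ HH := f3 s hs1 (fun b hb => lie_zero_symm (hcs b (f2 a ha b hb)))
    have hen : n = a - s := by rw [e]; abel
    exact ⟨s, n, e, ⟨hsH, hs⟩, by rw [hen]; exact HH.sub_mem ha hsH, hn⟩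
  have hl0 : ∀ v : g, ⁅x, v⁆ = 0 → θ v = v → v ∈ HH := by
    intro v hxv hv
    apply f4 v hv
    intro a ha
    obtain ⟨s, n, e, hs, hnH, hn⟩ := hJ a ha
    obtain ⟨N, hN⟩ := hn
    refine ⟨N, ?_⟩
    have key : ∀ m : ℕ, ⁅s, ((ad k g n) ^ m) v⁆ = 0 ∧ ((ad k g a) ^ m) v = ((ad k g n) ^ m) v := by
      intro m
      induction m with
      | zero => exact ⟨hgen v hxv s hs, rfl⟩
      | succ m ih =>
        rw [pow_succ', pow_succ', Module.End.mul_apply, Module.End.mul_apply, ih.2, ad_apply,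
          ad_apply]
        refine ⟨lie_zero_two (f2 s hs.1 n hnH) ih.1, ?_⟩
        rw [e, add_lie, ih.1, zero_add]
    rw [(key N).2, hN]; rfl
  have hHc : ∀ h ∈ HH, h ∈ c := by
    intro h hh
    obtain ⟨s, n, e, hs, hnH, hn⟩ := hJ h hh
    have hn0 : n = 0 := by
      refine nondeg1 θ i1 (δ := (1 : k)) (ε := 1) (by simp) hx (by simp) (by simpa using hx1)
        (by simpa using (f1 n hnH).1) (f2 x hxH n hnH) ?_
      intro z hz hz1
      exact killing_nil hn (f2 n hnH z (hl0 z hz (by simpa using hz1)))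
    rw [e, hn0, add_zero]; exact hs
  have hC : ∀ z : g, ⁅x, z⁆ = 0 → θ z = -z → θ' z = z → z = 0 := fun z h1 h2 h3 =>
    lemma_C θ θ' hcomm' hmax c (fun v hv => f1 v hv.1) hxc hx hgen
      (fun v hv hv1 _ => hHc v (hl0 v hv hv1)) h1 h2 h3
  have hlm : ∀ v : g, ⁅x, v⁆ = 0 → θ' v = -v := by
    intro v hv
    have hv' := ker_inv θ (Or.inl hx1) hv
    have h0 : θ' (v + θ v) = -(v + θ v) := by
      refine (f1 _ (hl0 (v + θ v) ?_ ?_)).2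
      · rw [lie_add, hv, hv', add_zero]
      · rw [lq_add, i1, add_comm]
    have hw : ⁅x, v - θ v⁆ = 0 := by rw [lie_sub, hv, hv', sub_zero]
    have hw' := ker_inv θ' (Or.inr hx2) hw
    have h1 : (v - θ v) + θ' (v - θ v) = 0 := by
      apply hC
      · rw [lie_add, hw, hw', add_zero]
      · rw [lq_add, i3, lq_sub, i1, lq_sub, lq_sub]; abel
      · rw [lq_add, i2, add_comm]
    have h2 : θ' (v - θ v) = -(v - θ v) := eq_neg_of_add_eq_zero_right h1
    have e := half_add (k := k) v (θ v)
    have h3 : θ' v = (2⁻¹ : k) • θ' (v + θ v) + (2⁻¹ : k) • θ' (v - θ v) := by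
      conv_lhs => rw [e]
      rw [lq_add, lq_smul, lq_smul]
    rw [h3, h0, h2, smul_neg, smul_neg, ← neg_add, ← e]
  obtain ⟨y, hyr, hxy, hyθ⟩ := lemma_W θ' i2 (max_reg hmax) hx hx2
  have hly : ∀ v : g, ⁅x, v⁆ = 0 → ⁅y, v⁆ = 0 := by
    intro v hv
    have h1 := hlm _ (lie_zero_two hxy hv)
    rw [LieEquiv.map_lie, hyθ, hlm v hv, neg_lie, lie_neg, neg_neg] at h1
    exact self_neg (k := k) h1
  refine ⟨x, ?_, hx1, hx2⟩
  rw [isRegular_iff_finrank_engel_eq_rank]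
  apply le_antisymm _ (rank_le_finrank_engel k x)
  rw [← (isRegular_iff_finrank_engel_eq_rank k y).mp hyr]
  apply Submodule.finrank_mono (R := k) (s := (LieSubalgebra.engel k x).toSubmodule)
  intro v hv
  exact mem_engel_one (hly v (ss_engel hx hv))

end

section
variable {k : Type*} [Field k] [IsAlgClosed k] [CharZero k]
variable {g : Type*} [LieRing g] [LieAlgebra k g] [FiniteDimensional k g]
  [LieAlgebra.IsSemisimple k g]

theorem mem_q01 (θ θ' : g ≃ₗ⁅k⁆ g) (x : g) :
    x ∈ qSpace k g θ θ' false true ↔ θ x = x ∧ θ' x = -x :=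
  and_congr (mem_eigp θ x) (mem_eigm θ' x)

theorem mem_q10 (θ θ' : g ≃ₗ⁅k⁆ g) (x : g) :
    x ∈ qSpace k g θ θ' true false ↔ θ x = -x ∧ θ' x = x :=
  and_congr (mem_eigm θ x) (mem_eigp θ' x)

theorem ss_ker {x : g} (hx : (ad k g x).IsSemisimple) :
    LinearMap.ker (ad k g x) = (LieSubalgebra.engel k x).toSubmodule := by
  ext v
  exact ⟨fun h => mem_engel_one (by simpa using h),
    fun h => by simpa using ss_engel hx h⟩

theorem reg_iff {x : g} : (IsSSElt k g x ∧ IsRegElt k g x) ↔ LieAlgebra.IsRegular k x := by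
  constructor
  · rintro ⟨hs, H, hH, h⟩
    rw [ss_ker hs] at h
    rw [LieAlgebra.isRegular_iff_finrank_engel_eq_rank, ← (cartan_gen hH).1]
    exact h
  · intro h
    refine ⟨reg_ss h, _, reg_cartan h, ?_⟩
    rw [ss_ker (reg_ss h)]
    rfl

theorem main_half (θ θ' : g ≃ₗ⁅k⁆ g) (hcomm : CommutingInvolutions k g θ θ')
    (h2 : IsMaxRank k g θ') :
    (∃ x ∈ qSpace k g θ θ' false true ⊔ qSpace k g θ θ' true false,
        IsSSElt k g x ∧ IsRegElt k g x) ↔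
      (∃ H : LieSubalgebra k (fixSubalgebra k g θ), H.IsCartanSubalgebra ∧
        ∀ y ∈ H, (y : g) ∈ qSpace k g θ θ' false true) := by
  constructor
  · rintro ⟨x, hx, hr⟩
    obtain ⟨a, ha, b, hb, rfl⟩ := Submodule.mem_sup.mp hx
    rw [mem_q01] at ha
    rw [mem_q10] at hb
    obtain ⟨y, hy, hy1, hy2⟩ := step1 θ θ' hcomm h2 ⟨a + b, by
      rw [lq_add, ha.2, hb.2, lq_add, lq_neg, ha.1, hb.1]; abel, reg_iff.mp hr⟩
    obtain ⟨H, hH, h⟩ := step2 θ θ' h2 hy hy1 hy2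
    exact ⟨H, hH, fun y hy => (mem_q01 θ θ' _).mpr (h y hy)⟩
  · rintro ⟨H, hH, h⟩
    obtain ⟨y, hy, hy1, hy2⟩ := step3 θ θ' hcomm h2 H hH
      (fun y hy => ((mem_q01 θ θ' _).mp (h y hy)).2)
    exact ⟨y, Submodule.mem_sup_left ((mem_q01 θ θ' _).mpr ⟨hy1, hy2⟩), reg_iff.mpr hy⟩
end

/-- For commuting involutions `θ, θ'` of maximal rank, the following are
equivalent: (i) `g₀₁ ⊕ g₁₀` contains a regular semisimple element of `g`;
(ii) `g₀₁` contains a Cartan subalgebra of `g^θ`;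
(iii) `g₁₀` contains a Cartan subalgebra of `g^{θ'}`. -/
theorem quasimaximal_equivalences (θ θ' : g ≃ₗ⁅k⁆ g)
    (hcomm : CommutingInvolutions k g θ θ')
    (h1 : IsMaxRank k g θ) (h2 : IsMaxRank k g θ') :
    ((∃ x ∈ qSpace k g θ θ' false true ⊔ qSpace k g θ θ' true false,
        IsSSElt k g x ∧ IsRegElt k g x) ↔
      (∃ H : LieSubalgebra k (fixSubalgebra k g θ), H.IsCartanSubalgebra ∧
        ∀ y ∈ H, (y : g) ∈ qSpace k g θ θ' false true)) ∧
    ((∃ H : LieSubalgebra k (fixSubalgebra k g θ), H.IsCartanSubalgebra ∧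
        ∀ y ∈ H, (y : g) ∈ qSpace k g θ θ' false true) ↔
      (∃ H : LieSubalgebra k (fixSubalgebra k g θ'), H.IsCartanSubalgebra ∧
        ∀ y ∈ H, (y : g) ∈ qSpace k g θ θ' true false)) := by
  have e1 : qSpace k g θ' θ false true = qSpace k g θ θ' true false := inf_comm _ _
  have e2 : qSpace k g θ' θ true false = qSpace k g θ θ' false true := inf_comm _ _
  have m1 := main_half θ θ' hcomm h2
  have m2 := main_half θ' θ ⟨hcomm.2.1, hcomm.1, fun x => (hcomm.2.2 x).symm⟩ h1
  rw [e1, e2, sup_comm] at m2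
  exact ⟨m1, m1.symm.trans m2⟩
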